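/- The logic HLC♭⊕t□⊕4a, where t□ := (⊤⇛p)→p and 4a := p⇛(⊤⇛p), has the finite model property: every finite consecution Γ ⇒ φ with Γ ⊬_{t□,4a} φ is refuted by some finite flat model whose underlying frame validates t□ and 4a. -/

import Mathlib

/-- Formulas of the language `L⇛`. -/
inductive Fml : Type where
  | var : Nat → Fml
  | top : Fml
  | bot : Fml
  | and : Fml → Fml → Fml
  | or  : Fml → Fml → Fml
  | imp : Fml → Fml → Fml
  | sto : Fml → Fml → Fml
deriving DecidableEq

/-- Uniform substitution. -/
def Fml.subst (σ : Nat → Fml) : Fml → Fml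
  | .var p => σ p
  | .top => .top
  | .bot => .bot
  | .and φ ψ => .and (φ.subst σ) (ψ.subst σ)
  | .or φ ψ => .or (φ.subst σ) (ψ.subst σ)
  | .imp φ ψ => .imp (φ.subst σ) (ψ.subst σ)
  | .sto φ ψ => .sto (φ.subst σ) (ψ.subst σ)

/-- Conjunction `φ₁ ∧ ⋯ ∧ φₙ` of a list of formulas (`⊤` for the empty list). -/
def Fml.conj : List Fml → Fml
  | [] => .top
  | [φ] => φ
  | φ :: ψ :: rest => .and φ (Fml.conj (ψ :: rest))

/-- Disjunction `φ₁ ∨ ⋯ ∨ φₙ` of a list of formulas (`⊥` for the empty list). -/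
def Fml.disj : List Fml → Fml
  | [] => .bot
  | [φ] => φ
  | φ :: ψ :: rest => .or φ (Fml.disj (ψ :: rest))

/-- Axiom schemes of intuitionistic propositional logic (a standard Hilbert-style
axiomatisation); as schemes, they comprise all substitution instances. -/
inductive IpcAx : Fml → Prop where
  | k (φ ψ : Fml) : IpcAx (.imp φ (.imp ψ φ))
  | s (φ ψ χ : Fml) : IpcAx (.imp (.imp φ (.imp ψ χ)) (.imp (.imp φ ψ) (.imp φ χ)))
  | andE1 (φ ψ : Fml) : IpcAx (.imp (.and φ ψ) φ)
  | andE2 (φ ψ : Fml) : IpcAx (.imp (.and φ ψ) ψ)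
  | andI (φ ψ : Fml) : IpcAx (.imp φ (.imp ψ (.and φ ψ)))
  | orI1 (φ ψ : Fml) : IpcAx (.imp φ (.or φ ψ))
  | orI2 (φ ψ : Fml) : IpcAx (.imp ψ (.or φ ψ))
  | orE (φ ψ χ : Fml) : IpcAx (.imp (.imp φ χ) (.imp (.imp ψ χ) (.imp (.or φ ψ) χ)))
  | botE (φ : Fml) : IpcAx (.imp .bot φ)
  | top : IpcAx .top

/-- Substitution instances of the axioms of intuitionistic logic together with
`k_a : ((p⇛q)∧(p⇛r))→(p⇛(q∧r))` and `tr : ((p⇛q)∧(q⇛r))→(p⇛r)`. -/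
inductive BaseAx : Fml → Prop where
  | ipc {φ : Fml} : IpcAx φ → BaseAx φ
  | ka (φ ψ χ : Fml) : BaseAx (.imp (.and (.sto φ ψ) (.sto φ χ)) (.sto φ (.and ψ χ)))
  | tr (φ ψ χ : Fml) : BaseAx (.imp (.and (.sto φ ψ) (.sto ψ χ)) (.sto φ χ))

/-- Derivability of the consecution `Γ ⇒ φ` in `HLC♭ ⊕ Ax`, i.e. `Γ ⊢_Ax φ`. -/
inductive Deriv (Ax : Set Fml) : Set Fml → Fml → Prop where
  | base {Γ : Set Fml} {φ : Fml} : BaseAx φ → Deriv Ax Γ φ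
  | axm {Γ : Set Fml} {ψ : Fml} (σ : Nat → Fml) : ψ ∈ Ax → Deriv Ax Γ (ψ.subst σ)
  | el {Γ : Set Fml} {φ : Fml} : φ ∈ Γ → Deriv Ax Γ φ
  | mp {Γ : Set Fml} {φ ψ : Fml} : Deriv Ax Γ φ → Deriv Ax Γ (.imp φ ψ) → Deriv Ax Γ ψ
  | na {Γ : Set Fml} {φ ψ : Fml} : Deriv Ax (∅ : Set Fml) (.imp φ ψ) → Deriv Ax Γ (.sto φ ψ)

/-- A flat frame: a nonempty set of worlds with a preorder `≼` and a relation `R`. -/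
structure FlatFrame : Type 1 where
  W : Type
  ne : Nonempty W
  le : W → W → Prop
  le_refl : ∀ w, le w w
  le_trans : ∀ ⦃w v u⦄, le w v → le v u → le w u
  R : W → W → Prop

/-- A valuation is admissible if every proposition letter denotes an upset. -/
def FlatFrame.IsUpset (F : FlatFrame) (V : Nat → F.W → Prop) : Prop :=
  ∀ p ⦃w v⦄, F.le w v → V p w → V p v

/-- Truth of a formula at a world of a flat model: the usual intuitionistic Kripke
clauses over `≼`, and `w ⊨ φ⇛ψ` iff for every `w' ≽ w`, `R[w'] ⊆ ⟦φ⟧` implies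
`R[w'] ⊆ ⟦ψ⟧`. -/
def FlatFrame.sat (F : FlatFrame) (V : Nat → F.W → Prop) : Fml → F.W → Prop
  | .var p, w => V p w
  | .top, _ => True
  | .bot, _ => False
  | .and φ ψ, w => F.sat V φ w ∧ F.sat V ψ w
  | .or φ ψ, w => F.sat V φ w ∨ F.sat V ψ w
  | .imp φ ψ, w => ∀ v, F.le w v → F.sat V φ v → F.sat V ψ v
  | .sto φ ψ, w => ∀ w', F.le w w' →
      (∀ v, F.R w' v → F.sat V φ v) → ∀ v, F.R w' v → F.sat V ψ v

/-- A flat frame validates the consecution `Γ ⇒ φ` if in every model on it, every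
world satisfying all formulas of `Γ` satisfies `φ`. -/
def FlatFrame.ValidCons (F : FlatFrame) (Γ : Set Fml) (φ : Fml) : Prop :=
  ∀ V, F.IsUpset V → ∀ w, (∀ ψ ∈ Γ, F.sat V ψ w) → F.sat V φ w

/-- A flat frame validates a formula if it is true at every world in every model on it. -/
def FlatFrame.ValidFml (F : FlatFrame) (φ : Fml) : Prop :=
  ∀ V, F.IsUpset V → ∀ w, F.sat V φ w

/-- `em := p ∨ ¬p` (where `¬φ` abbreviates `φ→⊥`). -/
def emFml : Fml := .or (.var 0) (.imp (.var 0) .bot)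
/-- `t□ := (⊤⇛p)→p`. -/
def tbFml : Fml := .imp (.sto .top (.var 0)) (.var 0)
/-- `str := (p→q)→(p⇛q)`. -/
def strFml : Fml := .imp (.imp (.var 0) (.var 1)) (.sto (.var 0) (.var 1))
/-- `p_a := (p⇛q)→(⊤⇛(p⇛q))`. -/
def paFml : Fml := .imp (.sto (.var 0) (.var 1)) (.sto .top (.sto (.var 0) (.var 1)))
/-- `4a := p⇛(⊤⇛p)`. -/
def fourAFml : Fml := .sto (.var 0) (.sto .top (.var 0))
/-- `di := ((p⇛r)∧(q⇛r))→((p∨q)⇛r)`. -/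
def diFml : Fml := .imp (.and (.sto (.var 0) (.var 2)) (.sto (.var 1) (.var 2)))
    (.sto (.or (.var 0) (.var 1)) (.var 2))

/-- The finite set of subformulas of a formula. -/
def Fml.subformulas : Fml → Finset Fml
  | .var p => {.var p}
  | .top => {.top}
  | .bot => {.bot}
  | .and φ ψ => insert (.and φ ψ) (φ.subformulas ∪ ψ.subformulas)
  | .or φ ψ => insert (.or φ ψ) (φ.subformulas ∪ ψ.subformulas)
  | .imp φ ψ => insert (.imp φ ψ) (φ.subformulas ∪ ψ.subformulas)
  | .sto φ ψ => insert (.sto φ ψ) (φ.subformulas ∪ ψ.subformulas)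

theorem Fml.mem_subformulas_self (φ : Fml) : φ ∈ φ.subformulas := by
  cases φ <;> simp [Fml.subformulas]

/-- A set of formulas is closed under immediate subformulas. -/
structure SubClosed (S : Set Fml) : Prop where
  and : ∀ {φ ψ}, Fml.and φ ψ ∈ S → φ ∈ S ∧ ψ ∈ S
  or : ∀ {φ ψ}, Fml.or φ ψ ∈ S → φ ∈ S ∧ ψ ∈ S
  imp : ∀ {φ ψ}, Fml.imp φ ψ ∈ S → φ ∈ S ∧ ψ ∈ S
  sto : ∀ {φ ψ}, Fml.sto φ ψ ∈ S → φ ∈ S ∧ ψ ∈ S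

theorem Fml.subClosed_subformulas (χ : Fml) : SubClosed (χ.subformulas : Set Fml) := by
  have self := Fml.mem_subformulas_self
  induction χ with
  | var p => constructor <;> simp [Fml.subformulas]
  | top => constructor <;> simp [Fml.subformulas]
  | bot => constructor <;> simp [Fml.subformulas]
  | and α β hα hβ | or α β hα hβ | imp α β hα hβ | sto α β hα hβ =>
    obtain ⟨a1, a2, a3, a4⟩ := hα
    obtain ⟨b1, b2, b3, b4⟩ := hβ
    constructor <;> intro φ ψ h <;>
      simp only [Fml.subformulas, Finset.mem_coe, Finset.mem_insert, Finset.mem_union] at * <;>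
      grind

theorem SubClosed.biUnion {ι : Type*} {I : Set ι} {S : ι → Set Fml}
    (h : ∀ i ∈ I, SubClosed (S i)) : SubClosed (⋃ i ∈ I, S i) := by
  constructor <;> intro φ ψ hm <;> simp only [Set.mem_iUnion] at hm ⊢ <;>
    obtain ⟨i, hi, hm⟩ := hm
  · exact ⟨⟨i, hi, ((h i hi).and hm).1⟩, ⟨i, hi, ((h i hi).and hm).2⟩⟩
  · exact ⟨⟨i, hi, ((h i hi).or hm).1⟩, ⟨i, hi, ((h i hi).or hm).2⟩⟩
  · exact ⟨⟨i, hi, ((h i hi).imp hm).1⟩, ⟨i, hi, ((h i hi).imp hm).2⟩⟩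
  · exact ⟨⟨i, hi, ((h i hi).sto hm).1⟩, ⟨i, hi, ((h i hi).sto hm).2⟩⟩

namespace Deriv

variable {Ax : Set Fml} {Γ Δ : Set Fml} {φ ψ χ : Fml}

theorem mono (hΓ : Γ ⊆ Δ) (h : Deriv Ax Γ φ) : Deriv Ax Δ φ := by
  induction h generalizing Δ with
  | base h => exact .base h
  | axm σ h => exact .axm σ h
  | el h => exact .el (hΓ h)
  | mp _ _ ih₁ ih₂ => exact .mp (ih₁ hΓ) (ih₂ hΓ)
  | na h _ => exact .na h

theorem imp_intro_of_deriv (h : Deriv Ax Γ ψ) : Deriv Ax Γ (.imp φ ψ) :=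
  .mp h (.base (.ipc (.k _ _)))

theorem imp_mp (h₁ : Deriv Ax Γ (.imp φ ψ)) (h₂ : Deriv Ax Γ (.imp φ (.imp ψ χ))) :
    Deriv Ax Γ (.imp φ χ) :=
  .mp h₁ (.mp h₂ (.base (.ipc (.s _ _ _))))

theorem imp_self : Deriv Ax Γ (.imp φ φ) :=
  imp_mp (ψ := .imp φ φ) (.base (.ipc (.k _ _))) (.base (.ipc (.k _ _)))

/-- The deduction theorem. -/
theorem deduction (h : Deriv Ax (insert φ Γ) ψ) : Deriv Ax Γ (.imp φ ψ) := by
  generalize hΔ : insert φ Γ = Δ at h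
  induction h with
  | base h => exact imp_intro_of_deriv (.base h)
  | axm σ h => exact imp_intro_of_deriv (.axm σ h)
  | el h =>
    subst hΔ
    rcases h with rfl | h
    · exact imp_self
    · exact imp_intro_of_deriv (.el h)
  | mp _ _ ih₁ ih₂ => exact imp_mp (ih₁ hΔ) (ih₂ hΔ)
  | na h _ => exact imp_intro_of_deriv (.na h)

theorem exists_of_sUnion {c : Set (Set Fml)} (hc : IsChain (· ⊆ ·) c) (hne : c.Nonempty)
    (h : Deriv Ax (⋃₀ c) φ) : ∃ s ∈ c, Deriv Ax s φ := by
  generalize hΔ : ⋃₀ c = Δ at h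
  induction h with
  | base h => exact ⟨_, hne.some_mem, .base h⟩
  | axm σ h => exact ⟨_, hne.some_mem, .axm σ h⟩
  | el h =>
    subst hΔ
    obtain ⟨s, hs, h⟩ := h
    exact ⟨s, hs, .el h⟩
  | mp _ _ ih₁ ih₂ =>
    obtain ⟨s, hs, h₁⟩ := ih₁ hΔ
    obtain ⟨t, ht, h₂⟩ := ih₂ hΔ
    rcases hc.total hs ht with hst | hts
    · exact ⟨t, ht, .mp (h₁.mono hst) h₂⟩
    · exact ⟨s, hs, .mp h₁ (h₂.mono hts)⟩
  | na h _ => exact ⟨_, hne.some_mem, .na h⟩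

theorem and_intro (h₁ : Deriv Ax Γ φ) (h₂ : Deriv Ax Γ ψ) : Deriv Ax Γ (.and φ ψ) :=
  .mp h₂ (.mp h₁ (.base (.ipc (.andI _ _))))

theorem sto_trans (h₁ : Deriv Ax Γ (.sto φ ψ)) (h₂ : Deriv Ax Γ (.sto ψ χ)) :
    Deriv Ax Γ (.sto φ χ) :=
  .mp (h₁.and_intro h₂) (.base (.tr _ _ _))

theorem sto_of_deriv_empty (h : Deriv Ax ∅ ψ) : Deriv Ax Γ (.sto φ ψ) :=
  .na h.imp_intro_of_deriv

theorem and_imp_elim : Deriv Ax Γ (.imp (.and φ (.imp φ ψ)) ψ) :=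
  imp_mp (.base (.ipc (.andE1 _ _))) (.base (.ipc (.andE2 _ _)))

theorem sto_mp (h₁ : Deriv Ax Γ (.sto φ ψ)) (h₂ : Deriv Ax Γ (.sto φ (.imp ψ χ))) :
    Deriv Ax Γ (.sto φ χ) :=
  sto_trans (.mp (h₁.and_intro h₂) (.base (.ka _ _ _))) (.na and_imp_elim)

end Deriv

/-- A set of formulas closed under derivability. -/
def IsThy (Ax T : Set Fml) : Prop := ∀ φ, Deriv Ax T φ → φ ∈ T

/-- A consistent theory with the disjunction property. -/
structure IsPrimeThy (Ax T : Set Fml) : Prop where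
  thy : IsThy Ax T
  bot : Fml.bot ∉ T
  or : ∀ {φ ψ}, Fml.or φ ψ ∈ T → φ ∈ T ∨ ψ ∈ T

/-- The set of `⇛`-consequences of `φ` according to `G`. -/
def stoSet (G : Set Fml) (φ : Fml) : Set Fml := {χ | Fml.sto φ χ ∈ G}

section Theories

variable {Ax : Set Fml} {T G : Set Fml} {φ ψ : Fml}

theorem IsThy.mp (hT : IsThy Ax T) (h : φ ∈ T) (h' : Deriv Ax T (.imp φ ψ)) : ψ ∈ T :=
  hT _ (.mp (.el h) h')

/-- Lindenbaum's lemma. -/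
theorem exists_isPrimeThy (h : ¬ Deriv Ax T φ) : ∃ P, T ⊆ P ∧ IsPrimeThy Ax P ∧ φ ∉ P := by
  obtain ⟨P, hTP, hP⟩ := zorn_subset_nonempty {Δ | ¬ Deriv Ax Δ φ}
    (fun c hc hchain hne => ⟨⋃₀ c, fun hd => by
      obtain ⟨s, hs, hd⟩ := hd.exists_of_sUnion hchain hne
      exact hc hs hd, fun s hs => Set.subset_sUnion_of_mem hs⟩) T h
  have key : ∀ χ, χ ∉ P → Deriv Ax P (.imp χ φ) := by
    intro χ hχ
    by_contra hn
    exact hχ (hP.le_of_ge (y := insert χ P) (fun hd => hn hd.deduction)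
      (Set.subset_insert _ _) (Set.mem_insert _ _))
  refine ⟨P, hTP, ⟨?_, ?_, ?_⟩, fun hφ => hP.prop (.el hφ)⟩
  · intro χ hχ
    by_contra hn
    exact hP.prop (.mp hχ (key χ hn))
  · exact fun hb => hP.prop (.mp (.el hb) (.base (.ipc (.botE _))))
  · intro α β hαβ
    by_contra! hn
    exact hP.prop (.mp (.el hαβ) (.mp (key β hn.2) (.mp (key α hn.1)
      (.base (.ipc (.orE _ _ _))))))

theorem IsThy.exists_isPrimeThy (hT : IsThy Ax T) (h : φ ∉ T) :
    ∃ P, T ⊆ P ∧ IsPrimeThy Ax P ∧ φ ∉ P :=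
  _root_.exists_isPrimeThy fun hd => h (hT _ hd)

theorem IsThy.isThy_stoSet (hG : IsThy Ax G) (φ : Fml) : IsThy Ax (stoSet G φ) := by
  intro χ h
  refine hG _ ?_
  generalize hΔ : stoSet G φ = Δ at h
  induction h with
  | base h => exact .sto_of_deriv_empty (.base h)
  | axm σ h => exact .sto_of_deriv_empty (.axm σ h)
  | el h => subst hΔ; exact .el h
  | mp _ _ ih₁ ih₂ => exact .sto_mp (ih₁ hΔ) (ih₂ hΔ)
  | na h _ => exact .sto_of_deriv_empty (.na h)

theorem IsThy.self_mem_stoSet (hG : IsThy Ax G) : φ ∈ stoSet G φ :=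
  hG _ (.na .imp_self)

end Theories

/-- A world of the canonical model: a prime theory `G` together with a theory `T` closed
under the relation `⇛` of `G`. -/
structure CanonWorld (Ax : Set Fml) where
  G : Set Fml
  T : Set Fml
  prime : IsPrimeThy Ax G
  thy : IsThy Ax T
  closed : ∀ {φ ψ}, Fml.sto φ ψ ∈ G → φ ∈ T → ψ ∈ T

namespace CanonWorld

variable {Ax : Set Fml}

/-- The canonical world with second component generated by `φ`. -/
def ofPrime {G : Set Fml} (hG : IsPrimeThy Ax G) (φ : Fml) : CanonWorld Ax where
  G := G
  T := stoSet G φ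
  prime := hG
  thy := hG.thy.isThy_stoSet φ
  closed h h' := hG.thy _ (.sto_trans (.el h') (.el h))

/-- The trace of a canonical world on `S`: the members of `S` in `G`, those whose box
`⊤⇛χ` is in `G`, and those in `T`. -/
def trace (S : Set Fml) (c : CanonWorld Ax) : Set S × Set S × Set S :=
  ({χ | χ.1 ∈ c.G}, {χ | Fml.sto .top χ.1 ∈ c.G}, {χ | χ.1 ∈ c.T})

theorem mem_T_of_box_mem (c : CanonWorld Ax) {φ : Fml} (h : Fml.sto .top φ ∈ c.G) : φ ∈ c.T :=
  c.closed h (c.thy _ (.base (.ipc .top)))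

theorem box_mem_T (c : CanonWorld Ax) (hAx : fourAFml ∈ Ax) {φ : Fml} (h : φ ∈ c.T) :
    Fml.sto .top φ ∈ c.T :=
  c.closed (c.prime.thy _ (.axm (fun _ => φ) hAx)) h

theorem mem_of_box_mem (c : CanonWorld Ax) (hAx : tbFml ∈ Ax) {φ : Fml}
    (h : Fml.sto .top φ ∈ c.G) : φ ∈ c.G :=
  c.prime.thy.mp h (.axm (fun _ => φ) hAx)

end CanonWorld

open CanonWorld

/-- The filtration of the canonical frame through `S`. -/
def filtration (Ax S : Set Fml) (c₀ : CanonWorld Ax) : FlatFrame where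
  W := Set.range (trace (Ax := Ax) S)
  ne := ⟨⟨_, c₀, rfl⟩⟩
  le x y := x.1.1 ⊆ y.1.1 ∧ x.1.2.1 ⊆ y.1.2.1
  le_refl _ := ⟨subset_rfl, subset_rfl⟩
  le_trans _ _ _ h h' := ⟨h.1.trans h'.1, h.2.trans h'.2⟩
  R x y := x.1.2.2 ⊆ y.1.2.1

section Filtration

variable {Ax S : Set Fml} {c₀ : CanonWorld Ax}

/-- The class of a canonical world in the filtration. -/
def filtration.mk (S : Set Fml) (c₀ c : CanonWorld Ax) : (filtration Ax S c₀).W :=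
  ⟨trace S c, c, rfl⟩

theorem filtration.exists_mk (x : (filtration Ax S c₀).W) :
    ∃ c, x = filtration.mk S c₀ c := by
  obtain ⟨_, c, rfl⟩ := x
  exact ⟨c, rfl⟩

theorem filtration.le_mk {c d : CanonWorld Ax} :
    (filtration Ax S c₀).le (mk S c₀ c) (mk S c₀ d) ↔
      (∀ χ ∈ S, χ ∈ c.G → χ ∈ d.G) ∧
        ∀ χ ∈ S, Fml.sto .top χ ∈ c.G → Fml.sto .top χ ∈ d.G := by
  simp [filtration, mk, trace]

theorem filtration.R_mk {c d : CanonWorld Ax} :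
    (filtration Ax S c₀).R (mk S c₀ c) (mk S c₀ d) ↔
      ∀ χ ∈ S, χ ∈ c.T → Fml.sto .top χ ∈ d.G := by
  simp [filtration, mk, trace]

/-- The canonical valuation on the filtration. -/
def filtration.val (S : Set Fml) (c₀ : CanonWorld Ax) : Nat → (filtration Ax S c₀).W → Prop :=
  fun p x => ∃ h : Fml.var p ∈ S, ⟨Fml.var p, h⟩ ∈ x.1.1

theorem filtration.isUpset_val : (filtration Ax S c₀).IsUpset (val S c₀) :=
  fun _ _ _ hle ⟨hS, h⟩ => ⟨hS, hle.1 h⟩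

theorem filtration.finite (hS : S.Finite) : Finite (filtration Ax S c₀).W := by
  have := hS.to_subtype
  exact inferInstanceAs (Finite (Set.range (trace (Ax := Ax) S)))

theorem filtration.valid_tbFml : (filtration Ax S c₀).ValidFml tbFml := by
  intro V _ w v _ h
  obtain ⟨c, rfl⟩ := exists_mk v
  exact h (mk S c₀ (.ofPrime c.prime .top)) (le_mk.2 ⟨fun _ _ h => h, fun _ _ h => h⟩)
    (fun _ _ => trivial) _ (R_mk.2 fun _ _ h => h)

theorem filtration.valid_fourAFml : (filtration Ax S c₀).ValidFml fourAFml := by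
  intro V _ w w' _ hp v hv v' hvv' _ u hu
  refine hp u ?_
  obtain ⟨a, rfl⟩ := exists_mk w'
  obtain ⟨b, rfl⟩ := exists_mk v
  obtain ⟨c, rfl⟩ := exists_mk v'
  obtain ⟨d, rfl⟩ := exists_mk u
  rw [R_mk] at *
  exact fun χ hχ h => hu χ hχ (c.mem_T_of_box_mem ((le_mk.1 hvv').2 χ hχ (hv χ hχ h)))

/-- The truth lemma for the filtration. -/
theorem filtration.sat_iff (hS : SubClosed S) (htb : tbFml ∈ Ax) (h4a : fourAFml ∈ Ax)
    (φ : Fml) (hφ : φ ∈ S) (c : CanonWorld Ax) :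
    (filtration Ax S c₀).sat (val S c₀) φ (mk S c₀ c) ↔ φ ∈ c.G := by
  induction φ generalizing c with
  | var p => exact ⟨fun ⟨_, h⟩ => h, fun h => ⟨hφ, h⟩⟩
  | top => exact ⟨fun _ => c.prime.thy _ (.base (.ipc .top)), fun _ => trivial⟩
  | bot => exact ⟨False.elim, c.prime.bot⟩
  | and α β ihα ihβ =>
    rw [FlatFrame.sat, ihα (hS.and hφ).1, ihβ (hS.and hφ).2]
    exact ⟨fun h => c.prime.thy _ (.and_intro (.el h.1) (.el h.2)),
      fun h => ⟨c.prime.thy.mp h (.base (.ipc (.andE1 _ _))),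
        c.prime.thy.mp h (.base (.ipc (.andE2 _ _)))⟩⟩
  | or α β ihα ihβ =>
    rw [FlatFrame.sat, ihα (hS.or hφ).1, ihβ (hS.or hφ).2]
    exact ⟨fun h => h.elim (fun h => c.prime.thy.mp h (.base (.ipc (.orI1 _ _))))
      (fun h => c.prime.thy.mp h (.base (.ipc (.orI2 _ _)))), c.prime.or⟩
  | imp α β ihα ihβ =>
    replace ihα := ihα (hS.imp hφ).1
    replace ihβ := ihβ (hS.imp hφ).2
    constructor
    · intro h
      by_contra hn
      obtain ⟨P, hcP, hP, hβ⟩ := exists_isPrimeThy (T := insert α c.G) (φ := β)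
        fun hd => hn (c.prime.thy _ hd.deduction)
      have hsub := (Set.subset_insert α c.G).trans hcP
      exact hβ ((ihβ (.ofPrime hP .top)).1 (h _ (le_mk.2
        ⟨fun _ _ h => hsub h, fun _ _ h => hsub h⟩)
        ((ihα (.ofPrime hP .top)).2 (hcP (Set.mem_insert _ _)))))
    · intro h v hle hα
      obtain ⟨d, rfl⟩ := exists_mk v
      rw [ihα] at hα
      exact (ihβ d).2 (d.prime.thy.mp hα (.el ((le_mk.1 hle).1 _ hφ h)))
  | sto α β ihα ihβ =>
    obtain ⟨hα, hβ⟩ := hS.sto hφ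
    replace ihα := ihα hα
    replace ihβ := ihβ hβ
    have refute : ∀ (d : CanonWorld Ax) (χ : Fml), χ ∉ d.T → ∃ e : CanonWorld Ax,
        (filtration Ax S c₀).R (mk S c₀ d) (mk S c₀ e) ∧ χ ∉ e.G := by
      intro d χ hχ
      obtain ⟨P, hTP, hP, hχP⟩ := d.thy.exists_isPrimeThy hχ
      exact ⟨.ofPrime hP .top, R_mk.2 fun _ _ h => hTP (d.box_mem_T h4a h), hχP⟩
    constructor
    · intro h
      by_contra hn
      obtain ⟨e, hR, he⟩ := refute (.ofPrime c.prime α) β hn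
      refine he ((ihβ e).1 (h (mk S c₀ (.ofPrime c.prime α))
        (le_mk.2 ⟨fun _ _ h => h, fun _ _ h => h⟩) ?_ _ hR))
      intro v hv
      obtain ⟨d, rfl⟩ := exists_mk v
      exact (ihα d).2 (d.mem_of_box_mem htb (R_mk.1 hv α hα c.prime.thy.self_mem_stoSet))
    · intro h w' hle hw' v hv
      obtain ⟨d, rfl⟩ := exists_mk w'
      obtain ⟨u, rfl⟩ := exists_mk v
      have hαd : α ∈ d.T := by
        by_contra hn
        obtain ⟨e, hR, he⟩ := refute d α hn
        exact he ((ihα e).1 (hw' _ hR))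
      exact (ihβ u).2 (u.mem_of_box_mem htb
        (R_mk.1 hv β hβ (d.closed ((le_mk.1 hle).1 _ hφ h) hαd)))

end Filtration

/-- `HLC♭ ⊕ t□ ⊕ 4a` has the finite model property: every finite
consecution `Γ ⇒ φ` with `Γ ⊬_{t□,4a} φ` is refuted in a finite flat model whose
underlying frame validates `t□` and `4a`. -/
theorem fmp_tb_4a (Γ : Set Fml) (φ : Fml) (hfin : Γ.Finite)
    (h : ¬ Deriv {tbFml, fourAFml} Γ φ) :
    ∃ (F : FlatFrame) (V : Nat → F.W → Prop), Finite F.W ∧ F.IsUpset V ∧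
      F.ValidFml tbFml ∧ F.ValidFml fourAFml ∧
      ∃ w : F.W, (∀ ψ ∈ Γ, F.sat V ψ w) ∧ ¬ F.sat V φ w := by
  obtain ⟨P, hΓP, hP, hφP⟩ := exists_isPrimeThy h
  let S : Set Fml := ⋃ ψ ∈ insert φ Γ, (ψ.subformulas : Set Fml)
  have hS : SubClosed S := .biUnion fun ψ _ => ψ.subClosed_subformulas
  have hSfin : S.Finite := (hfin.insert φ).biUnion fun ψ _ => ψ.subformulas.finite_toSet
  have hmem : ∀ ψ ∈ insert φ Γ, ψ ∈ S := fun ψ hψ =>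
    Set.mem_biUnion hψ ψ.mem_subformulas_self
  let c : CanonWorld {tbFml, fourAFml} := .ofPrime hP .top
  have truth := fun ψ hψ => filtration.sat_iff (c₀ := c) hS (by simp) (by simp) ψ (hmem ψ hψ) c
  exact ⟨filtration _ S c, filtration.val S c, filtration.finite hSfin, filtration.isUpset_val,
    filtration.valid_tbFml, filtration.valid_fourAFml, filtration.mk S c c,
    fun ψ hψ => (truth ψ (.inr hψ)).2 (hΓP hψ), fun hs => hφP ((truth φ (.inl rfl)).1 hs)⟩
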